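/- arXiv:2105.04335 — 4 statements merged into one kernel-verified Lean document; each statement's English description precedes it below -/
import Mathlib

section
/- Let L ∈ ℝ^{n×n} be the Laplacian matrix of a strongly connected weighted digraph, i.e., L has nonpositive off-diagonal entries, every row of L sums to zero, and L is irreducible. Then for every standard basis vector e_i of ℝⁿ, e_i does not lie in the column space of L and e_i does not lie in the column space of Lᵀ. -/
open Matrix

/-- `L` is a Laplacian matrix: nonpositive off-diagonal entries and zero row sums. -/
def IsLaplacian {n : ℕ} (L : Matrix (Fin n) (Fin n) ℝ) : Prop :=
  (∀ i j, i ≠ j → L i j ≤ 0) ∧ (∀ i, ∑ j, L i j = 0)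

/-- The digraph of `L` (edge `(i,j)` whenever `i ≠ j` and `L i j ≠ 0`) is strongly
connected; this is equivalent to irreducibility of `L`. -/
def StronglyConnected {n : ℕ} (L : Matrix (Fin n) (Fin n) ℝ) : Prop :=
  ∀ i j : Fin n, Relation.ReflTransGen (fun a b => a ≠ b ∧ L a b ≠ 0) i j

/-- For the Laplacian matrix of a strongly connected weighted digraph, no standard basis
vector `eᵢ` lies in the column space of `L` or of `Lᵀ`. -/
theorem stmt13 {n : ℕ} (L : Matrix (Fin n) (Fin n) ℝ)
    (hL : IsLaplacian L) (hIrr : StronglyConnected L) :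
    ∀ i : Fin n,
      (¬ ∃ x : Fin n → ℝ, L.mulVec x = (Pi.single i 1 : Fin n → ℝ)) ∧
      (¬ ∃ x : Fin n → ℝ, L.transpose.mulVec x = (Pi.single i 1 : Fin n → ℝ)) := by
  intro i
  obtain ⟨hoff, hrow⟩ := hL
  constructor
  · rintro ⟨x, hx⟩
    have hk : ∀ k, ∑ j, L k j * (x j - x k) = (Pi.single i 1 : Fin n → ℝ) k := by
      intro k
      rw [← hx]
      simp only [mul_sub, Finset.sum_sub_distrib, ← Finset.sum_mul, hrow, zero_mul, sub_zero]
      rfl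
    have hnn : ∀ k, 0 ≤ (Pi.single i 1 : Fin n → ℝ) k := by
      intro k
      by_cases h : k = i
      · subst h; simp
      · simp [h]
    haveI : Nonempty (Fin n) := ⟨i⟩
    obtain ⟨m, hm⟩ := Finite.exists_min x
    have hstep : ∀ b, x b = x m := by
      intro b
      induction hIrr m b with
      | refl => rfl
      | @tail a c _ hac ih =>
        have hle : ∀ j ∈ Finset.univ, L a j * (x j - x a) ≤ 0 := by
          intro j _
          by_cases h : a = j
          · subst h; simp
          · exact mul_nonpos_of_nonpos_of_nonneg (hoff a j h) (by rw [ih]; linarith [hm j])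
        have hs : ∑ j, L a j * (x j - x a) = 0 :=
          le_antisymm (Finset.sum_nonpos hle) (by rw [hk]; exact hnn a)
        have h0 := (Finset.sum_eq_zero_iff_of_nonpos hle).1 hs c (Finset.mem_univ c)
        rcases mul_eq_zero.1 h0 with h | h
        · exact absurd h hac.2
        · linarith
    have := hk i
    simp [hstep] at this
  · rintro ⟨x, hx⟩
    have h1 : ∑ j, (L.transpose.mulVec x) j = 1 := by rw [hx]; simp
    have h2 : ∑ j, (L.transpose.mulVec x) j = 0 := by
      simp only [Matrix.mulVec, dotProduct, Matrix.transpose_apply]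
      rw [Finset.sum_comm]
      simp [← Finset.sum_mul, hrow]
    linarith
end

section
/- Let L ∈ ℝ^{n×n} be an irreducible Laplacian matrix. Then: (a) for every s₀ > 0, the matrix s₀I + L is invertible and every entry of (s₀I + L)^{-1} is strictly positive; (b) for every standard basis vector e_i, e_i does not lie in the column space of L. Consequently, for the first-order multi-agent system ẋ = −Lx + e_i d, y = e_jᵀx on a strongly connected digraph, placing a single sensor at any node e_j successfully defends against every zero-dynamics attack d(t) = −e^{s₀t}d₀, s₀ ≥ 0, launched at any node e_i. -/
open Matrix

theorem lap_key {n : ℕ} (L : Matrix (Fin n) (Fin n) ℝ)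
    (hL : IsLaplacian L) (hIrr : StronglyConnected L) (s : ℝ) (hs : 0 ≤ s)
    (v : Fin n → ℝ)
    (hw : ∀ k, 0 ≤ ((s • (1 : Matrix (Fin n) (Fin n) ℝ) + L).mulVec v) k)
    (i : Fin n) (hi : ((s • (1 : Matrix (Fin n) (Fin n) ℝ) + L).mulVec v) i ≠ 0)
    (j : Fin n) : 0 < s * v j := by
  obtain ⟨hoff, hrow⟩ := hL
  have hM : ∀ k, ((s • (1 : Matrix (Fin n) (Fin n) ℝ) + L).mulVec v) k
      = s * v k + ∑ j, L k j * (v j - v k) := by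
    intro k
    have h1 : ∑ j, L k j * (v j - v k) = ∑ j, L k j * v j := by
      simp only [mul_sub, Finset.sum_sub_distrib]
      rw [← Finset.sum_mul, hrow k]
      ring
    rw [h1, Matrix.add_mulVec, Matrix.smul_mulVec, Matrix.one_mulVec]
    rfl
  haveI : Nonempty (Fin n) := ⟨i⟩
  obtain ⟨k, hk⟩ := Finite.exists_min v
  by_contra hj
  have hsk : s * v k ≤ 0 := le_trans (mul_le_mul_of_nonneg_left (hk j) hs) (not_lt.mp hj)
  have hterm : ∀ a, v a = v k → ∀ b, L a b * (v b - v a) ≤ 0 := by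
    intro a ha b
    by_cases hab : a = b
    · subst hab
      simp
    · exact mul_nonpos_of_nonpos_of_nonneg (hoff a b hab) (by rw [ha]; linarith [hk b])
  have hconst : ∀ b, v b = v k := by
    intro b
    induction hIrr k b with
    | refl => rfl
    | @tail a b _ hab ih =>
      have h0 := hw a
      rw [hM a, ih] at h0
      have hle : ∑ j, L a j * (v j - v a) ≤ 0 := Finset.sum_nonpos fun b _ => hterm a ih b
      rw [← ih] at h0 hsk
      have hz : ∑ j, L a j * (v j - v a) = 0 := le_antisymm hle (by linarith)
      have hb := (Finset.sum_eq_zero_iff_of_nonpos fun b _ => hterm a ih b).mp hz b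
        (Finset.mem_univ b)
      rcases mul_eq_zero.mp hb with h | h
      · exact absurd h hab.2
      · linarith
  apply hi
  have h0 := hw i
  rw [hM i] at h0 ⊢
  simp only [hconst, sub_self, mul_zero, Finset.sum_const_zero, add_zero] at h0 ⊢
  exact le_antisymm hsk h0

theorem lap_key_single {n : ℕ} (L : Matrix (Fin n) (Fin n) ℝ)
    (hL : IsLaplacian L) (hIrr : StronglyConnected L) (s : ℝ) (hs : 0 ≤ s)
    (v : Fin n → ℝ) (i : Fin n)
    (hw : (s • (1 : Matrix (Fin n) (Fin n) ℝ) + L).mulVec v = Pi.single i 1)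
    (j : Fin n) : 0 < s * v j := by
  refine lap_key L hL hIrr s hs v ?_ i ?_ j
  · intro k
    rw [hw]
    by_cases h : k = i
    · subst h
      simp
    · simp [h]
  · rw [hw]
    simp

theorem lap_unit {n : ℕ} (L : Matrix (Fin n) (Fin n) ℝ)
    (hL : IsLaplacian L) (hIrr : StronglyConnected L) (s : ℝ) (hs : 0 < s) :
    IsUnit (s • (1 : Matrix (Fin n) (Fin n) ℝ) + L) := by
  rw [← Matrix.mulVec_injective_iff_isUnit, ← Matrix.coe_mulVecLin,
    ← LinearMap.ker_eq_bot, LinearMap.ker_eq_bot']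
  intro v hv
  rw [Matrix.mulVecLin_apply] at hv
  funext k
  by_contra hvk
  have hvk : v k ≠ 0 := hvk
  have hL1 : L.mulVec (fun _ => 1) = 0 := by
    funext a
    simp [Matrix.mulVec, dotProduct, hL.2 a]
  have h : (s • (1 : Matrix (Fin n) (Fin n) ℝ) + L).mulVec ((-(v k)⁻¹) • v + fun _ => 1)
      = fun _ => s := by
    rw [Matrix.mulVec_add, Matrix.mulVec_smul, hv, Matrix.add_mulVec, hL1,
      Matrix.smul_mulVec, Matrix.one_mulVec]
    funext a
    simp
  have := lap_key L hL hIrr s hs.le _ (by intro a; rw [h]; exact hs.le) k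
    (by rw [h]; exact hs.ne') k
  simp [hvk] at this

/-- For an irreducible Laplacian `L`: (a) for every `s₀ > 0`, `s₀ I + L` is invertible
with entrywise strictly positive inverse; (b) no `eᵢ` lies in the column space of `L`.
Consequently, for the first-order multi-agent system `ẋ = −Lx + eᵢ d`, `y = eⱼᵀ x` on a
strongly connected digraph, every solution `(ζ, d₀)` of the Rosenbrock equations with
`s₀ ≥ 0` has `d₀ = 0`: a single sensor at any node `eⱼ` defends against every
zero-dynamics attack `d(t) = −e^{s₀ t} d₀` launched at any node `eᵢ`. -/
theorem stmt15 {n : ℕ} (L : Matrix (Fin n) (Fin n) ℝ)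
    (hL : IsLaplacian L) (hIrr : StronglyConnected L) :
    (∀ s₀ : ℝ, 0 < s₀ →
      IsUnit (s₀ • (1 : Matrix (Fin n) (Fin n) ℝ) + L) ∧
      ∀ x y, 0 < ((s₀ • (1 : Matrix (Fin n) (Fin n) ℝ) + L)⁻¹) x y) ∧
    (∀ i : Fin n, ¬ ∃ x : Fin n → ℝ, L.mulVec x = (Pi.single i 1 : Fin n → ℝ)) ∧
    (∀ i j : Fin n, ∀ s₀ : ℝ, 0 ≤ s₀ → ∀ (ζ : Fin n → ℝ) (d₀ : ℝ),
      (s₀ • (1 : Matrix (Fin n) (Fin n) ℝ) + L).mulVec ζ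
          + d₀ • (Pi.single i 1 : Fin n → ℝ) = 0 →
      (Pi.single j 1 : Fin n → ℝ) ⬝ᵥ ζ = 0 → d₀ = 0) := by
  refine ⟨fun s hs => ?_, ?_, ?_⟩
  · have hu := lap_unit L hL hIrr s hs
    refine ⟨hu, fun x y => ?_⟩
    have hd := (Matrix.isUnit_iff_isUnit_det _).mp hu
    have := lap_key_single L hL hIrr s hs.le
      ((s • (1 : Matrix (Fin n) (Fin n) ℝ) + L)⁻¹.mulVec (Pi.single y 1)) y
      (by rw [Matrix.mulVec_mulVec, Matrix.mul_nonsing_inv _ hd, Matrix.one_mulVec]) x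
    have h2 := pos_of_mul_pos_right this hs.le
    rw [Matrix.mulVec_single_one] at h2
    exact h2
  · rintro i ⟨x, hx⟩
    have := lap_key_single L hL hIrr 0 le_rfl x i (by simpa using hx) i
    simp at this
  · intro i j s hs ζ d h1 h2
    by_contra hd
    have := lap_key_single L hL hIrr s hs ((-d⁻¹) • ζ) i (by
      rw [Matrix.mulVec_smul, eq_neg_of_add_eq_zero_left h1, smul_neg, neg_smul, neg_neg,
        smul_smul, inv_mul_cancel₀ hd, one_smul]) j
    rw [single_one_dotProduct] at h2
    simp [h2] at this
end

section
/- Let L ∈ ℝ^{n×n} be an irreducible Laplacian matrix, let K = diag(k₁,…,kₙ) be a diagonal matrix with k_i > 0 for all i, and let s₀ > 0. Then the matrix s₀²I + s₀K + L is invertible and every entry of (s₀²I + s₀K + L)^{-1} is strictly positive. -/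
open Matrix

lemma lap_mulVec_apply {n : ℕ} (L : Matrix (Fin n) (Fin n) ℝ) (k : Fin n → ℝ) (s : ℝ)
    (x : Fin n → ℝ) (i : Fin n) :
    ((s ^ 2 • (1 : Matrix (Fin n) (Fin n) ℝ) + s • Matrix.diagonal k + L) *ᵥ x) i
      = (s ^ 2 + s * k i) * x i + ∑ j, L i j * x j := by
  rw [Matrix.add_mulVec, Matrix.add_mulVec, Matrix.smul_mulVec, Matrix.smul_mulVec,
    Matrix.one_mulVec]
  simp only [Pi.add_apply, Pi.smul_apply, smul_eq_mul, Matrix.mulVec_diagonal]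
  simp only [Matrix.mulVec, dotProduct]
  ring

lemma lap_nonneg {n : ℕ} (L : Matrix (Fin n) (Fin n) ℝ) (hL : IsLaplacian L)
    (d : Fin n → ℝ) (hd : ∀ i, 0 < d i) (x : Fin n → ℝ)
    (hx : ∀ i, 0 ≤ d i * x i + ∑ j, L i j * x j) : ∀ i, 0 ≤ x i := by
  intro i
  haveI : Nonempty (Fin n) := ⟨i⟩
  obtain ⟨m, hm⟩ := Finite.exists_min x
  have h1 : ∑ j, L m j * x j = ∑ j, L m j * (x j - x m) := by
    simp only [mul_sub, Finset.sum_sub_distrib, ← Finset.sum_mul, hL.2 m]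
    ring
  have h2 : ∑ j, L m j * (x j - x m) ≤ 0 := by
    apply Finset.sum_nonpos
    intro j _
    by_cases h : m = j
    · subst h; simp
    · exact mul_nonpos_of_nonpos_of_nonneg (hL.1 m j h) (sub_nonneg.2 (hm j))
  have h3 := hx m
  have h4 : 0 ≤ x m := by
    by_contra hneg
    push Not at hneg
    have := mul_neg_of_pos_of_neg (hd m) hneg
    linarith
  exact h4.trans (hm i)

lemma lap_zero_step {n : ℕ} (L : Matrix (Fin n) (Fin n) ℝ) (hL : IsLaplacian L)
    (d : Fin n → ℝ) (x : Fin n → ℝ)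
    (hx : ∀ i, 0 ≤ d i * x i + ∑ j, L i j * x j) (hx0 : ∀ i, 0 ≤ x i)
    (a b : Fin n) (hab : a ≠ b ∧ L a b ≠ 0) (ha : x a = 0) : x b = 0 := by
  have h := hx a
  rw [ha, mul_zero, zero_add] at h
  have ht : ∀ j ∈ Finset.univ, L a j * x j ≤ 0 := by
    intro j _
    by_cases e : a = j
    · subst e; simp [ha]
    · exact mul_nonpos_of_nonpos_of_nonneg (hL.1 a j e) (hx0 j)
  have h0 := (Finset.sum_eq_zero_iff_of_nonpos ht).1 (le_antisymm (Finset.sum_nonpos ht) h) b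
    (Finset.mem_univ b)
  exact (mul_eq_zero.1 h0).resolve_left hab.2

/-- For an irreducible Laplacian `L`, a positive diagonal matrix `K = diag(k₁,…,kₙ)` and
`s₀ > 0`, the matrix `s₀² I + s₀ K + L` is invertible and its inverse is entrywise
strictly positive. -/
theorem stmt16 {n : ℕ} (L : Matrix (Fin n) (Fin n) ℝ)
    (hL : IsLaplacian L) (hIrr : StronglyConnected L)
    (k : Fin n → ℝ) (hk : ∀ i, 0 < k i)
    (s₀ : ℝ) (hs₀ : 0 < s₀) :
    IsUnit (s₀ ^ 2 • (1 : Matrix (Fin n) (Fin n) ℝ) + s₀ • Matrix.diagonal k + L) ∧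
    ∀ i j, 0 < ((s₀ ^ 2 • (1 : Matrix (Fin n) (Fin n) ℝ)
        + s₀ • Matrix.diagonal k + L)⁻¹) i j := by
  have hd : ∀ i, 0 < s₀ ^ 2 + s₀ * k i := fun i => by have := hk i; positivity
  have hU : IsUnit (s₀ ^ 2 • (1 : Matrix (Fin n) (Fin n) ℝ) + s₀ • Matrix.diagonal k + L) := by
    rw [← Matrix.mulVec_injective_iff_isUnit]
    intro x y hxy
    have key : ∀ u v : Fin n → ℝ,
        (s₀ ^ 2 • (1 : Matrix (Fin n) (Fin n) ℝ) + s₀ • Matrix.diagonal k + L) *ᵥ u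
        = (s₀ ^ 2 • (1 : Matrix (Fin n) (Fin n) ℝ) + s₀ • Matrix.diagonal k + L) *ᵥ v →
        ∀ i, 0 ≤ (u - v) i := by
      intro u v huv
      apply lap_nonneg L hL _ hd
      intro i
      rw [← lap_mulVec_apply, Matrix.mulVec_sub, huv, sub_self]
      simp
    funext i
    have h1 := key x y hxy i
    have h2 := key y x hxy.symm i
    simp only [Pi.sub_apply] at h1 h2
    linarith
  refine ⟨hU, fun i j => ?_⟩
  set A := s₀ ^ 2 • (1 : Matrix (Fin n) (Fin n) ℝ) + s₀ • Matrix.diagonal k + L with hA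
  have hAx : A *ᵥ (fun i => A⁻¹ i j) = Pi.single j 1 := by
    have h := Matrix.mul_nonsing_inv A ((Matrix.isUnit_iff_isUnit_det A).1 hU)
    funext i
    have h' := congrFun (congrFun h i) j
    rw [Matrix.mul_apply] at h'
    rw [Matrix.one_apply] at h'
    simp only [Matrix.mulVec, dotProduct, Pi.single_apply]
    exact h'
  have hx : ∀ i, 0 ≤ (s₀ ^ 2 + s₀ * k i) * A⁻¹ i j + ∑ l, L i l * A⁻¹ l j := by
    intro i
    have := lap_mulVec_apply L k s₀ (fun i => A⁻¹ i j) i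
    rw [← this, ← hA, hAx, Pi.single_apply]
    split_ifs <;> norm_num
  have hx0 := lap_nonneg L hL _ hd (fun i => A⁻¹ i j) hx
  refine lt_of_le_of_ne (hx0 i) fun h0 => ?_
  have hall : ∀ b, A⁻¹ b j = 0 := by
    intro b
    induction hIrr i b with
    | refl => exact h0.symm
    | tail _ hab ih => exact lap_zero_step L hL _ (fun i => A⁻¹ i j) hx hx0 _ _ hab ih
  have h1 := congrFun hAx j
  simp [Matrix.mulVec, dotProduct, hall] at h1
end

section
/- Let L ∈ ℝ^{n×n} be an irreducible Laplacian matrix and let r > 0 and s₀ > 0. Then the matrix s₀I + rL is invertible and (s₀I + rL)^{-1}L is again an irreducible Laplacian matrix: it has nonpositive off-diagonal entries and nonnegative diagonal entries, every row sums to zero, and it is irreducible. -/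
open Matrix

theorem aux_apply {n : ℕ} (L : Matrix (Fin n) (Fin n) ℝ) (hL : IsLaplacian L)
    (r s₀ : ℝ) (x : Fin n → ℝ) (i : Fin n) :
    ((s₀ • (1 : Matrix (Fin n) (Fin n) ℝ) + r • L) *ᵥ x) i
      = s₀ * x i + r * ∑ j, L i j * (x j - x i) := by
  have h : ∑ j, L i j * (x j - x i) = ∑ j, L i j * x j := by
    simp only [mul_sub, Finset.sum_sub_distrib, ← Finset.sum_mul, hL.2 i]
    simp
  rw [h, Matrix.add_mulVec, Matrix.smul_mulVec, Matrix.smul_mulVec, Matrix.one_mulVec]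
  simp [Matrix.mulVec, dotProduct]

theorem aux_sum_nonpos {n : ℕ} (L : Matrix (Fin n) (Fin n) ℝ) (hL : IsLaplacian L)
    (x : Fin n → ℝ) (i : Fin n) (hi : ∀ j, x i ≤ x j) (j : Fin n) :
    L i j * (x j - x i) ≤ 0 := by
  by_cases hij : i = j
  · subst hij; simp
  · exact mul_nonpos_of_nonpos_of_nonneg (hL.1 i j hij) (sub_nonneg.2 (hi j))

theorem aux_max {n : ℕ} (L : Matrix (Fin n) (Fin n) ℝ) (hL : IsLaplacian L)
    (r s₀ : ℝ) (hr : 0 < r) (hs₀ : 0 < s₀) (x : Fin n → ℝ)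
    (hx : ∀ i, 0 ≤ ((s₀ • (1 : Matrix (Fin n) (Fin n) ℝ) + r • L) *ᵥ x) i) (k : Fin n) :
    0 ≤ x k := by
  haveI : Nonempty (Fin n) := ⟨k⟩
  obtain ⟨i, hi⟩ := Finite.exists_min x
  refine le_trans ?_ (hi k)
  have h := hx i
  rw [aux_apply L hL] at h
  have h2 : ∑ j, L i j * (x j - x i) ≤ 0 :=
    Finset.sum_nonpos fun j _ => aux_sum_nonpos L hL x i hi j
  have h3 := mul_nonpos_of_nonneg_of_nonpos hr.le h2
  by_contra hneg
  have := mul_neg_of_pos_of_neg hs₀ (not_le.1 hneg)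
  linarith

/-- For an irreducible Laplacian `L` and `r, s₀ > 0`, the matrix `s₀ I + r L` is
invertible and `(s₀ I + r L)⁻¹ L` is again an irreducible Laplacian matrix: nonpositive
off-diagonal entries, nonnegative diagonal entries, zero row sums, and irreducible. -/
theorem stmt18 {n : ℕ} (L : Matrix (Fin n) (Fin n) ℝ)
    (hL : IsLaplacian L) (hIrr : StronglyConnected L)
    (r : ℝ) (hr : 0 < r) (s₀ : ℝ) (hs₀ : 0 < s₀) :
    IsUnit (s₀ • (1 : Matrix (Fin n) (Fin n) ℝ) + r • L) ∧
    let P : Matrix (Fin n) (Fin n) ℝ :=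
      (s₀ • (1 : Matrix (Fin n) (Fin n) ℝ) + r • L)⁻¹ * L
    (∀ i j, i ≠ j → P i j ≤ 0) ∧
    (∀ i, 0 ≤ P i i) ∧
    (∀ i, ∑ j, P i j = 0) ∧
    StronglyConnected P := by
  set M := s₀ • (1 : Matrix (Fin n) (Fin n) ℝ) + r • L with hM
  have hU : IsUnit M := by
    rw [← Matrix.mulVec_injective_iff_isUnit]
    intro x y hxy
    have h0 : M *ᵥ (x - y) = 0 := by
      rw [Matrix.mulVec_sub]; exact sub_eq_zero.2 hxy
    have h0' : M *ᵥ (y - x) = 0 := by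
      rw [Matrix.mulVec_sub]; exact sub_eq_zero.2 hxy.symm
    funext k
    have h1 := aux_max L hL r s₀ hr hs₀ (x - y) (fun i => by rw [← hM, h0]; simp) k
    have h2 := aux_max L hL r s₀ hr hs₀ (y - x) (fun i => by rw [← hM, h0']; simp) k
    simp only [Pi.sub_apply] at h1 h2
    linarith
  refine ⟨hU, ?_⟩
  intro P
  have hdet : IsUnit M.det := (Matrix.isUnit_iff_isUnit_det M).1 hU
  have hMN : M * M⁻¹ = 1 := Matrix.mul_nonsing_inv M hdet
  have hNM : M⁻¹ * M = 1 := Matrix.nonsing_inv_mul M hdet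
  have hcol : ∀ i j, (M *ᵥ (fun k => M⁻¹ k j)) i = (1 : Matrix (Fin n) (Fin n) ℝ) i j := by
    intro i j
    rw [← hMN]; rfl
  have hN0 : ∀ i j, 0 ≤ M⁻¹ i j := by
    intro i j
    refine aux_max L hL r s₀ hr hs₀ (fun k => M⁻¹ k j) (fun k => ?_) i
    rw [← hM, hcol, Matrix.one_apply]
    split_ifs <;> norm_num
  have hz : ∀ i j, M⁻¹ i j = 0 → ∀ k, L i k * (M⁻¹ k j - M⁻¹ i j) ≤ 0 := by
    intro i j h k
    exact aux_sum_nonpos L hL (fun k => M⁻¹ k j) i (fun k => by simp only [h]; exact hN0 k j) k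
  have heq : ∀ i j, s₀ * M⁻¹ i j + r * ∑ k, L i k * (M⁻¹ k j - M⁻¹ i j)
      = (1 : Matrix (Fin n) (Fin n) ℝ) i j := by
    intro i j
    rw [← hcol i j, hM, aux_apply L hL]
  have hdiag : ∀ j, M⁻¹ j j ≠ 0 := by
    intro j h
    have h1 := heq j j
    have h2 := mul_nonpos_of_nonneg_of_nonpos hr.le
      (Finset.sum_nonpos fun k (_ : k ∈ Finset.univ) => hz j j h k)
    rw [Matrix.one_apply_eq] at h1
    have h3 : s₀ * M⁻¹ j j = 0 := by rw [h, mul_zero]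
    linarith
  have hedge : ∀ i j, i ≠ j → L i j ≠ 0 → M⁻¹ i j ≠ 0 := by
    intro i j hij hLij h
    have h1 := heq i j
    rw [Matrix.one_apply_ne hij] at h1
    have h3 : s₀ * M⁻¹ i j = 0 := by rw [h, mul_zero]
    have h4 : ∑ k, L i k * (M⁻¹ k j - M⁻¹ i j) = 0 := by
      rw [h3, zero_add] at h1
      exact (mul_eq_zero.1 h1).resolve_left hr.ne'
    have h5 := (Finset.sum_eq_zero_iff_of_nonpos fun k _ => hz i j h k).1 h4 j (Finset.mem_univ j)
    rw [h, sub_zero] at h5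
    exact (mul_ne_zero hLij (hdiag j)) h5
  have hP : ∀ i j, r * P i j = (1 : Matrix (Fin n) (Fin n) ℝ) i j - s₀ * M⁻¹ i j := by
    have e : s₀ • M⁻¹ + r • P = 1 := by
      rw [← hNM]
      conv_rhs => rw [hM]
      rw [← hM, Matrix.mul_add, Matrix.mul_smul, Matrix.mul_smul, Matrix.mul_one]
    intro i j
    rw [← e]
    simp
  have hoff : ∀ i j, i ≠ j → P i j ≤ 0 := by
    intro i j hij
    have h1 := hP i j
    rw [Matrix.one_apply_ne hij] at h1
    have h2 := mul_nonneg hs₀.le (hN0 i j)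
    by_contra hc
    have := mul_pos hr (not_le.1 hc)
    linarith
  have hsum : ∀ i, ∑ j, P i j = 0 := by
    intro i
    have : ∀ j, P i j = ∑ k, M⁻¹ i k * L k j := fun j => Matrix.mul_apply
    simp only [this]
    rw [Finset.sum_comm]
    simp only [← Finset.mul_sum, hL.2, mul_zero, Finset.sum_const_zero]
  refine ⟨hoff, ?_, hsum, ?_⟩
  · intro i
    have h1 := hsum i
    rw [← Finset.add_sum_erase _ _ (Finset.mem_univ i)] at h1
    have h2 : ∑ j ∈ Finset.univ.erase i, P i j ≤ 0 :=
      Finset.sum_nonpos fun j hj => hoff i j (Finset.ne_of_mem_erase hj).symm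
    linarith
  · intro i j
    refine Relation.ReflTransGen.mono ?_ i j (hIrr i j)
    rintro a b ⟨hab, hLab⟩
    refine ⟨hab, fun h => ?_⟩
    have h1 := hP a b
    rw [Matrix.one_apply_ne hab, h, mul_zero, zero_sub] at h1
    exact mul_ne_zero hs₀.ne' (hedge a b hab hLab) (by linarith)
end
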